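/- There exists a universal constant c > 0 with the following property. Let δ ≥ 1 and k ≥ 1 be integers, let d ≥ k and 0 < ε ≤ 1 and ψ ≥ 1 be reals, and let G = (V, E) be a geometric directed graph in ℝ^δ with n = |V| vertices that satisfies the kissing-type hypothesis with parameter ψ (for every v ∈ V and every Q ⊆ V \ {v} such that every q ∈ Q satisfies dist(q, v) ≤ dist(q, q') for all q' ∈ Q \ {q}, one has |Q| ≤ ψ) and that is ε-far from being a k-NN graph with respect to degree bound d (for every edge set E' ⊆ V × V such that (V, E') with the same coordinates is a k-NN graph, |E Δ E'| > ε·d·n). Let s = ⌈c·√n/ε⌉ and t = ⌈c·k·ψ·√n⌉, and assume s ≤ n. If S is a uniformly random s-element subset of V and T = (T_1, …, T_t) are t independent uniformly random elements of V, independent of S, then with probability at least 2/3 there exists a vertex v ∈ S such that deg(v) < k, or there exists an index i such that T_i ≠ v, |{w ∈ V : w ≠ v and dist(v, w) < dist(v, T_i)}| ≤ k − 1, and (v, T_i) ∉ E. -/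

import Mathlib

attribute [local instance] Classical.propDecidable

/-- The out-neighborhood `N(v)` of a vertex in a directed graph given by an edge set. -/
noncomputable def nbrs {V : Type*} [Fintype V] (E : Finset (V × V)) (v : V) : Finset V :=
  Finset.univ.filter (fun u => (v, u) ∈ E)

/-- `(V, E)` with coordinates `coord` is a `k`-NN graph: every vertex `v` has a set `K`
of `min k (|V| - 1)` vertices other than `v`, all of them out-neighbors of `v`, that are
at least as close to `v` as every vertex outside `K ∪ {v}`. -/
def IsKNNGraph {V : Type*} [Fintype V] {δ : ℕ} (k : ℕ)
    (coord : V → EuclideanSpace ℝ (Fin δ)) (E : Finset (V × V)) : Prop :=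
  ∀ v : V, ∃ K : Finset V, v ∉ K ∧ K.card = min k (Fintype.card V - 1) ∧
    (∀ u ∈ K, (v, u) ∈ E) ∧
    ∀ u ∈ K, ∀ w : V, w ∉ K → w ≠ v →
      dist (coord v) (coord u) ≤ dist (coord v) (coord w)

open Finset in
/-- The `j` elements of `A` on which `f` is smallest, ties being broken arbitrarily. -/
lemma exists_subset_card_eq_forall_le {V : Type*} (f : V → ℝ) (A : Finset V) (j : ℕ)
    (hj : j ≤ A.card) :
    ∃ K ⊆ A, K.card = j ∧ ∀ u ∈ K, ∀ w ∈ A, w ∉ K → f u ≤ f w := by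
  induction j with
  | zero => exact ⟨∅, by simp, by simp, by simp⟩
  | succ j ih =>
    obtain ⟨K, hKA, hKc, hK⟩ := ih (by omega)
    have hne : (A \ K).Nonempty := by
      rw [← card_pos, card_sdiff_of_subset hKA]
      omega
    obtain ⟨x, hx, hmin⟩ := exists_min_image (A \ K) f hne
    rw [mem_sdiff] at hx
    refine ⟨insert x K, insert_subset hx.1 hKA, by rw [card_insert_of_notMem hx.2, hKc], ?_⟩
    intro u hu w hw hwK
    rw [mem_insert, not_or] at hwK
    rcases mem_insert.1 hu with rfl | hu
    · exact hmin w (mem_sdiff.2 ⟨hw, hwK.2⟩)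
    · exact hK u hu w hw hwK.2

/-- Greedy selection: if `u` is among the `k` nearest neighbors of every point of `A`, then at
least a `1 / k` fraction of `A` can be chosen so that `u` is a nearest neighbor of every chosen
point among `u` and the other chosen points. -/
lemma exists_subset_forall_dist_le {V P : Type*} [Fintype V] [PseudoMetricSpace P] (coord : V → P)
    (k : ℕ) (u : V) (A : Finset V)
    (hA : ∀ v ∈ A, (Finset.univ.filter (fun w => w ≠ v ∧
      dist (coord v) (coord w) < dist (coord v) (coord u))).card + 1 ≤ k) :
    ∃ Q ⊆ A, (∀ q ∈ Q, ∀ q' ∈ Q, q' ≠ q →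
      dist (coord q) (coord u) ≤ dist (coord q) (coord q')) ∧ A.card ≤ k * Q.card := by
  induction A using Finset.strongInduction with
  | H A ih =>
    rcases A.eq_empty_or_nonempty with rfl | hne
    · exact ⟨∅, by simp, by simp, by simp⟩
    obtain ⟨q, hq, hmax⟩ := Finset.exists_max_image A (fun v => dist (coord v) (coord u)) hne
    set A' := A.filter (fun w => w ≠ q ∧ ¬ dist (coord q) (coord w) < dist (coord q) (coord u))
      with hA'
    have hsub : A' ⊆ A := Finset.filter_subset _ _
    have hqA' : q ∉ A' := by simp [hA']
    obtain ⟨Q, hQA, hQ, hcard⟩ := ih A' (Finset.ssubset_iff_subset_ne.2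
      ⟨hsub, fun h => hqA' (h ▸ hq)⟩) (fun v hv => hA v (hsub hv))
    have hqQ : q ∉ Q := fun h => hqA' (hQA h)
    refine ⟨insert q Q, Finset.insert_subset hq (hQA.trans hsub), ?_, ?_⟩
    · have hfar : ∀ x ∈ Q, dist (coord q) (coord u) ≤ dist (coord q) (coord x) := fun x hx =>
        not_lt.1 (Finset.mem_filter.1 (hQA hx)).2.2
      intro a ha b hb hab
      rcases Finset.mem_insert.1 ha with rfl | haQ <;>
        rcases Finset.mem_insert.1 hb with rfl | hbQ
      · exact absurd rfl hab
      · exact hfar b hbQ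
      · rw [dist_comm (coord a) (coord b)]
        exact (hmax a (hsub (hQA haQ))).trans (hfar a haQ)
      · exact hQ a haQ b hbQ hab
    · have hcover : A ⊆ A' ∪ insert q (Finset.univ.filter (fun w => w ≠ q ∧
          dist (coord q) (coord w) < dist (coord q) (coord u))) := by
        intro x hx
        simp only [hA', Finset.mem_union, Finset.mem_insert, Finset.mem_filter, Finset.mem_univ,
          true_and]
        tauto
      have h1 := (Finset.card_le_card hcover).trans (Finset.card_union_le _ _)
      have h2 := Finset.card_insert_le q (Finset.univ.filter (fun w => w ≠ q ∧
          dist (coord q) (coord w) < dist (coord q) (coord u)))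
      have h3 := hA q hq
      rw [Finset.card_insert_of_notMem hqQ, mul_add, mul_one]
      omega

/-- A vertex missing one of the edges to its `k` nearest neighbors `K`, whichever ties are chosen,
has a non-neighbor with fewer than `k` vertices strictly closer. -/
lemma exists_missing_neighbor {V P : Type*} [Fintype V] [PseudoMetricSpace P] (coord : V → P)
    (E : Finset (V × V)) (k : ℕ) (v : V) (K : Finset V) (hvK : v ∉ K) (hKk : K.card ≤ k)
    (hK : ∀ u ∈ K, ∀ w : V, w ∉ K → w ≠ v → dist (coord v) (coord u) ≤ dist (coord v) (coord w))
    (hE : ¬ ∀ u ∈ K, (v, u) ∈ E) :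
    ∃ u, u ≠ v ∧ (Finset.univ.filter (fun w => w ≠ v ∧
      dist (coord v) (coord w) < dist (coord v) (coord u))).card ≤ k - 1 ∧ (v, u) ∉ E := by
  push Not at hE
  obtain ⟨u, hu, huE⟩ := hE
  refine ⟨u, fun h => hvK (h ▸ hu), ?_, huE⟩
  have hsub : Finset.univ.filter (fun w => w ≠ v ∧
      dist (coord v) (coord w) < dist (coord v) (coord u)) ⊆ K.erase u := by
    intro w hw
    obtain ⟨-, hwv, hlt⟩ := Finset.mem_filter.1 hw
    refine Finset.mem_erase.2 ⟨fun h => by simp [h] at hlt, ?_⟩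
    by_contra hwK
    exact absurd (hK u hu w hwK hwv) (not_le.2 hlt)
  have := Finset.card_le_card hsub
  rw [Finset.card_erase_of_mem hu] at this
  omega

/-- A graph that needs many edge changes to become a `k`-NN graph has many vertices from which a
`k`-nearest-neighbor edge is missing. -/
lemma exists_missing_neighbors_of_far {V : Type*} [Fintype V] {δ : ℕ} (k : ℕ)
    (coord : V → EuclideanSpace ℝ (Fin δ)) (E : Finset (V × V)) :
    ∃ (I : Finset V) (f : V → V) (E' : Finset (V × V)), IsKNNGraph k coord E' ∧
      (symmDiff E E').card ≤ k * I.card ∧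
      ∀ v ∈ I, f v ≠ v ∧ (Finset.univ.filter (fun w => w ≠ v ∧
        dist (coord v) (coord w) < dist (coord v) (coord (f v)))).card ≤ k - 1 ∧
        (v, f v) ∉ E := by
  have hex : ∀ v : V, ∃ K : Finset V, v ∉ K ∧ K.card = min k (Fintype.card V - 1) ∧
      ∀ u ∈ K, ∀ w : V, w ∉ K → w ≠ v → dist (coord v) (coord u) ≤ dist (coord v) (coord w) := by
    intro v
    obtain ⟨K, hKs, hKc, hK⟩ := exists_subset_card_eq_forall_le
      (fun w => dist (coord v) (coord w)) (Finset.univ.erase v) (min k (Fintype.card V - 1))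
      (by simp [Finset.card_erase_of_mem])
    exact ⟨K, fun h => by simpa using hKs h, hKc,
      fun u hu w hw hwv => hK u hu w (by simp [hwv]) hw⟩
  choose K hvK hKc hK using hex
  set I := Finset.univ.filter (fun v => ¬ ∀ u ∈ K v, (v, u) ∈ E) with hI
  have hf : ∀ v : V, ∃ u, v ∈ I → u ≠ v ∧ (Finset.univ.filter (fun w => w ≠ v ∧
      dist (coord v) (coord w) < dist (coord v) (coord u))).card ≤ k - 1 ∧ (v, u) ∉ E := by
    intro v
    by_cases hv : v ∈ I
    · obtain ⟨u, hu⟩ := exists_missing_neighbor coord E k v (K v) (hvK v)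
        (by rw [hKc]; exact min_le_left _ _) (hK v) (Finset.mem_filter.1 hv).2
      exact ⟨u, fun _ => hu⟩
    · exact ⟨v, fun h => absurd h hv⟩
  choose f hf using hf
  set F := I.biUnion (fun v => (K v).image (fun u => (v, u))) with hF
  refine ⟨I, f, E ∪ F, ?_, ?_, hf⟩
  · intro v
    refine ⟨K v, hvK v, hKc v, fun u hu => ?_, hK v⟩
    by_cases hv : v ∈ I
    · exact Finset.mem_union_right _ (Finset.mem_biUnion.2
        ⟨v, hv, Finset.mem_image_of_mem _ hu⟩)
    · simp only [hI, Finset.mem_filter, Finset.mem_univ, true_and, not_not] at hv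
      exact Finset.mem_union_left _ (hv u hu)
  · have hsub : symmDiff E (E ∪ F) ⊆ F := by
      intro x hx
      rw [Finset.mem_symmDiff, Finset.mem_union] at hx
      tauto
    refine (Finset.card_le_card hsub).trans ?_
    rw [mul_comm]
    refine Finset.card_biUnion_le_card_mul _ _ _ (fun v _ => Finset.card_image_le.trans ?_)
    rw [hKc]
    exact min_le_left _ _

/-- Each element lies in a proportion `s / n` of the `s`-element subsets. -/
lemma card_filter_mem_powersetCard {V : Type*} [Fintype V] (v : V) (s : ℕ) :
    (Fintype.card V : ℝ) *
      (((Finset.univ : Finset V).powersetCard s).filter (fun S => v ∈ S)).card =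
      s * (Fintype.card V).choose s := by
  rcases s with _ | s
  · simp
  have h := Finset.card_filter_powersetCard_subset {v} (Finset.univ : Finset V) (s + 1)
    (Finset.subset_univ _) (by simp)
  simp only [Finset.singleton_subset_iff, Finset.card_univ, Finset.card_singleton,
    Nat.add_sub_cancel] at h
  rw [h]
  have : Nonempty V := ⟨v⟩
  obtain ⟨n, hn⟩ := Nat.exists_eq_succ_of_ne_zero (Fintype.card_ne_zero (α := V))
  rw [hn]
  have := Nat.add_one_mul_choose_eq n s
  rw [Nat.succ_sub_one, mul_comm ((s + 1 : ℕ) : ℝ)]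
  exact_mod_cast this

/-- Two elements lie together in a proportion at most `(s / n) ^ 2` of the `s`-element subsets. -/
lemma card_filter_mem_mem_powersetCard_le {V : Type*} [Fintype V] {v w : V} (hvw : v ≠ w)
    (s : ℕ) :
    (Fintype.card V : ℝ) ^ 2 *
      (((Finset.univ : Finset V).powersetCard s).filter (fun S => v ∈ S ∧ w ∈ S)).card ≤
      s ^ 2 * (Fintype.card V).choose s := by
  rcases lt_or_ge (Fintype.card V) s with hs | hs
  · simp [Finset.powersetCard_eq_empty.2 (Finset.card_univ (α := V) ▸ hs)]
    positivity
  rcases s with _ | _ | s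
  · simp [Finset.filter_singleton]
  · have : ((Finset.univ : Finset V).powersetCard (0 + 1)).filter (fun S => v ∈ S ∧ w ∈ S) = ∅ := by
      refine Finset.filter_eq_empty_iff.2 fun S hS h => hvw ?_
      exact Finset.card_le_one.1 (Finset.mem_powersetCard.1 hS).2.le v h.1 w h.2
    rw [this]
    simp
  have h := Finset.card_filter_powersetCard_subset {v, w} (Finset.univ : Finset V) (s + 2)
    (Finset.subset_univ _) (by simp [Finset.card_pair hvw])
  simp only [Finset.insert_subset_iff, Finset.singleton_subset_iff, Finset.card_univ,
    Finset.card_pair hvw, Nat.add_sub_cancel] at h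
  rw [h]
  obtain ⟨n, hn⟩ : ∃ n, Fintype.card V = n + 2 := ⟨Fintype.card V - 2, by omega⟩
  rw [hn] at hs ⊢
  have h1 : ((n : ℝ) + 2) * (n + 1).choose (s + 1) = (n + 2).choose (s + 2) * (s + 2) := by
    exact_mod_cast Nat.add_one_mul_choose_eq (n + 1) (s + 1)
  have h2 : ((n : ℝ) + 1) * n.choose s = (n + 1).choose (s + 1) * (s + 1) := by
    exact_mod_cast Nat.add_one_mul_choose_eq n s
  have hsn : (s : ℝ) ≤ n := by exact_mod_cast (by omega : s ≤ n)
  have hC : (0 : ℝ) ≤ (n + 2).choose (s + 2) := Nat.cast_nonneg _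
  rw [Nat.add_sub_cancel]
  push_cast
  have hn0 : (0 : ℝ) < (n : ℝ) + 1 := by positivity
  refine le_of_mul_le_mul_left ?_ hn0
  calc ((n : ℝ) + 1) * ((n + 2) ^ 2 * n.choose s)
      = ((n : ℝ) + 2) * (s + 1) * (s + 2) * (n + 2).choose (s + 2) := by
        linear_combination (n + 2 : ℝ) ^ 2 * h2 + ((n : ℝ) + 2) * (s + 1) * h1
    _ ≤ ((n : ℝ) + 1) * ((s + 1 + 1) ^ 2 * (n + 2).choose (s + 2)) := by
        have : ((n : ℝ) + 2) * (s + 1) * (s + 2) ≤ (n + 1) * (s + 1 + 1) ^ 2 := by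
          nlinarith [mul_nonneg (sub_nonneg.2 hsn) (by positivity : (0 : ℝ) ≤ s + 2)]
        nlinarith

/-- Chebyshev's inequality for the hypergeometric distribution. -/
lemma card_filter_card_inter_lt_mul_le {V : Type*} [Fintype V] [Nonempty V] (I : Finset V) (s : ℕ)
    (μ : ℝ) (hμ : μ = I.card * s / Fintype.card V) (hpos : 0 < μ) :
    ((((Finset.univ : Finset V).powersetCard s).filter
      (fun S => ((S ∩ I).card : ℝ) < μ / 2)).card : ℝ) * μ ≤ 4 * (Fintype.card V).choose s := by
  set P := (Finset.univ : Finset V).powersetCard s with hP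
  set N := ((Fintype.card V).choose s : ℝ) with hN
  have hn : (0 : ℝ) < Fintype.card V := by exact_mod_cast Fintype.card_pos
  have hN0 : 0 ≤ N := Nat.cast_nonneg _
  have hPN : (P.card : ℝ) = N := by simp [hP, hN]
  have hcard : ∀ S : Finset V, ((S ∩ I).card : ℝ) = ∑ v ∈ I, if v ∈ S then 1 else 0 := by
    intro S
    rw [Finset.sum_boole, Finset.inter_comm, Finset.filter_mem_eq_inter]
  have hone : ∀ v : V, ((P.filter (fun S => v ∈ S)).card : ℝ) = s / Fintype.card V * N := by
    intro v
    have := card_filter_mem_powersetCard v s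
    field_simp
    linarith
  have htwo : ∀ v w : V, v ≠ w → ((P.filter (fun S => v ∈ S ∧ w ∈ S)).card : ℝ) ≤
      (s / Fintype.card V) ^ 2 * N := by
    intro v w hvw
    have := card_filter_mem_mem_powersetCard_le hvw s
    rw [div_pow, div_mul_eq_mul_div, le_div_iff₀ (by positivity)]
    linarith
  have hmean : ∑ S ∈ P, ((S ∩ I).card : ℝ) = μ * N := by
    simp_rw [hcard]
    rw [Finset.sum_comm]
    simp_rw [Finset.sum_boole, hone]
    rw [Finset.sum_const, nsmul_eq_mul, hμ]
    ring
  have hsq : ∑ S ∈ P, ((S ∩ I).card : ℝ) ^ 2 ≤ μ * N + μ ^ 2 * N := by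
    calc ∑ S ∈ P, ((S ∩ I).card : ℝ) ^ 2
        = ∑ v ∈ I, ∑ w ∈ I, ((P.filter (fun S => v ∈ S ∧ w ∈ S)).card : ℝ) := by
          simp_rw [hcard, sq, Finset.sum_mul_sum, ite_zero_mul_ite_zero, mul_one]
          rw [Finset.sum_comm]
          refine Finset.sum_congr rfl fun v _ => ?_
          rw [Finset.sum_comm]
          refine Finset.sum_congr rfl fun w _ => ?_
          rw [Finset.sum_boole]
      _ ≤ ∑ v ∈ I, ∑ w ∈ I, ((if v = w then s / Fintype.card V * N else 0) +
            (s / Fintype.card V) ^ 2 * N) := by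
          refine Finset.sum_le_sum fun v _ => Finset.sum_le_sum fun w _ => ?_
          split_ifs with h
          · subst h
            simp only [and_self, hone]
            have : (0 : ℝ) ≤ (s / Fintype.card V) ^ 2 * N := by positivity
            linarith
          · rw [zero_add]
            exact htwo v w h
      _ = μ * N + μ ^ 2 * N := by
          simp only [Finset.sum_add_distrib, Finset.sum_ite_eq, Finset.sum_const, nsmul_eq_mul,
            ← Finset.sum_filter, Finset.filter_mem_eq_inter, Finset.inter_self]
          rw [hμ]
          ring
  have hvar : ∑ S ∈ P, (((S ∩ I).card : ℝ) - μ) ^ 2 ≤ μ * N := by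
    have : ∑ S ∈ P, (((S ∩ I).card : ℝ) - μ) ^ 2 =
        ∑ S ∈ P, ((S ∩ I).card : ℝ) ^ 2 - 2 * μ * ∑ S ∈ P, ((S ∩ I).card : ℝ) + N * μ ^ 2 := by
      rw [← hPN, ← nsmul_eq_mul, ← Finset.sum_const, Finset.mul_sum, ← Finset.sum_sub_distrib,
        ← Finset.sum_add_distrib]
      exact Finset.sum_congr rfl fun S _ => by ring
    rw [this, hmean]
    linarith
  have hlow : ((P.filter (fun S => ((S ∩ I).card : ℝ) < μ / 2)).card : ℝ) * (μ / 2) ^ 2 ≤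
      ∑ S ∈ P, (((S ∩ I).card : ℝ) - μ) ^ 2 := by
    rw [← nsmul_eq_mul]
    refine (Finset.card_nsmul_le_sum _ _ _ fun S hS => ?_).trans
      (Finset.sum_le_sum_of_subset_of_nonneg (Finset.filter_subset _ _)
        fun _ _ _ => sq_nonneg _)
    have := (Finset.mem_filter.1 hS).2
    nlinarith
  refine le_of_mul_le_mul_right ?_ hpos
  linarith [hlow.trans hvar]

/-- The number of `t`-tuples avoiding a set of size at least `x`. -/
lemma card_forall_notMem_le {V : Type*} [Fintype V] [Nonempty V] (U : Finset V) (t : ℕ) (x : ℝ)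
    (hx : x ≤ U.card) :
    ((Finset.univ.filter (fun T : Fin t → V => ∀ i, T i ∉ U)).card : ℝ) ≤
      (Fintype.card V : ℝ) ^ t * Real.exp (-(t * x / Fintype.card V)) := by
  have hn : (0 : ℝ) < Fintype.card V := by exact_mod_cast Fintype.card_pos
  have hset : Finset.univ.filter (fun T : Fin t → V => ∀ i, T i ∉ U) =
      Fintype.piFinset fun _ => Uᶜ := by
    ext T
    simp
  rw [hset, Fintype.card_piFinset_const, Finset.card_compl, Nat.cast_pow,
    Nat.cast_sub (Finset.card_le_univ U)]
  have hexp : Real.exp (-(t * x / Fintype.card V)) = Real.exp (-(x / Fintype.card V)) ^ t := by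
    rw [← Real.exp_nat_mul]
    ring_nf
  rw [hexp, ← mul_pow]
  refine pow_le_pow_left₀ (sub_nonneg.2 (by exact_mod_cast Finset.card_le_univ U)) ?_ t
  calc (Fintype.card V : ℝ) - U.card ≤ Fintype.card V - x := by linarith
    _ = Fintype.card V * (-(x / Fintype.card V) + 1) := by field_simp; ring
    _ ≤ _ := by gcongr; exact Real.add_one_le_exp _

/-- soundness of the property tester, the core of Theorem 1: there is a
universal constant `c > 0` such that for every graph satisfying the kissing-type
hypothesis with parameter `ψ` that is `ε`-far from being a `k`-NN graph, a uniformly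
random `s`-element subset `S` of `V` together with `t` independent uniform draws
`T : Fin t → V` (with `s = ⌈c·√n/ε⌉`, `t = ⌈c·k·ψ·√n⌉`) detects, with probability at
least `2/3`, a vertex `v ∈ S` with `deg(v) < k` or with a missing `k`-nearest-neighbor
edge witnessed by some `T i`. The probability is expressed by counting pairs `(S, T)`. -/
theorem stmt10 : ∃ c : ℝ, 0 < c ∧
    ∀ (δ k : ℕ), 1 ≤ δ → 1 ≤ k → ∀ (d ε ψ : ℝ), (k : ℝ) ≤ d → 0 < ε → ε ≤ 1 → 1 ≤ ψ →
    ∀ (V : Type) [Fintype V],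
    ∀ (coord : V → EuclideanSpace ℝ (Fin δ)) (E : Finset (V × V)),
    (∀ v : V, ∀ Q : Finset V, v ∉ Q →
      (∀ q ∈ Q, ∀ q' ∈ Q, q' ≠ q →
        dist (coord q) (coord v) ≤ dist (coord q) (coord q')) →
      (Q.card : ℝ) ≤ ψ) →
    (∀ E' : Finset (V × V), IsKNNGraph k coord E' →
      ε * d * (Fintype.card V : ℝ) < ((symmDiff E E').card : ℝ)) →
    ∀ s t : ℕ,
      s = ⌈c * Real.sqrt (Fintype.card V) / ε⌉₊ →
      t = ⌈c * (k : ℝ) * ψ * Real.sqrt (Fintype.card V)⌉₊ →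
      s ≤ Fintype.card V →
    (2 / 3 : ℝ) * (((Fintype.card V).choose s : ℝ) * (Fintype.card V : ℝ) ^ t) ≤
      (((((Finset.univ : Finset V).powersetCard s) ×ˢ
          (Finset.univ : Finset (Fin t → V))).filter
        (fun ST => ∃ v ∈ ST.1, (nbrs E v).card < k ∨ ∃ i : Fin t,
          ST.2 i ≠ v ∧
          (Finset.univ.filter (fun w => w ≠ v ∧
            dist (coord v) (coord w) < dist (coord v) (coord (ST.2 i)))).card ≤ k - 1 ∧
          (v, ST.2 i) ∉ E)).card : ℝ) := by
  refine ⟨20, by norm_num, ?_⟩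
  intro δ k _ hk d ε ψ hkd hε _ hψ V _ coord E hkiss hfar s t hs ht _
  obtain ⟨I, f, E', hE', hcardE', hf⟩ := exists_missing_neighbors_of_far k coord E
  set n := (Fintype.card V : ℝ) with hn
  have hk0 : (0 : ℝ) < k := by exact_mod_cast hk
  have hd0 : 0 < d := hk0.trans_le hkd
  have hI : ε * n < I.card := by
    have h1 := hfar E' hE'
    have h2 : ((symmDiff E E').card : ℝ) ≤ k * I.card := by exact_mod_cast hcardE'
    have h3 : (k : ℝ) * I.card ≤ d * I.card := by gcongr
    refine lt_of_mul_lt_mul_left ?_ hd0.le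
    linarith
  have hn0 : 0 ≤ n := Nat.cast_nonneg _
  have hIpos : (0 : ℝ) < I.card := (by positivity : 0 ≤ ε * n).trans_lt hI
  obtain ⟨v₀, -⟩ := Finset.card_pos.1 (Nat.cast_pos.1 hIpos)
  have : Nonempty V := ⟨v₀⟩
  have hn1 : 1 ≤ n := by
    rw [hn]
    exact_mod_cast Fintype.card_pos (α := V)
  have hnpos : 0 < n := by linarith
  have hr1 : 1 ≤ Real.sqrt n := Real.one_le_sqrt.2 hn1
  have hrr : Real.sqrt n * Real.sqrt n = n := Real.mul_self_sqrt hn0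
  have hs' : 20 * Real.sqrt n / ε ≤ s := hs ▸ Nat.le_ceil _
  have ht' : 20 * k * ψ * Real.sqrt n ≤ t := ht ▸ Nat.le_ceil _
  set μ : ℝ := I.card * s / n with hμ
  have hμr : 20 * Real.sqrt n ≤ μ := by
    rw [hμ, le_div_iff₀ hnpos]
    calc 20 * Real.sqrt n * n = ε * n * (20 * Real.sqrt n / ε) := by field_simp
      _ ≤ I.card * s := by gcongr
  have hμ20 : 20 ≤ μ := by linarith
  have hfib : ∀ J ⊆ I, (J.card : ℝ) ≤ k * ψ * (J.image f).card := by
    intro J hJ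
    have hfloor : J.card ≤ ⌊k * ψ⌋₊ * (J.image f).card := by
      refine Finset.card_le_mul_card_image _ _ fun u _ => ?_
      obtain ⟨Q, hQA, hQ, hcard⟩ := exists_subset_forall_dist_le coord k u
        (J.filter (fun v => f v = u)) (fun v hv => by
          obtain ⟨hvJ, rfl⟩ := Finset.mem_filter.1 hv
          have := (hf v (hJ hvJ)).2.1
          omega)
      have huQ : u ∉ Q := fun h => by
        obtain ⟨huJ, hu⟩ := Finset.mem_filter.1 (hQA h)
        exact (hf u (hJ huJ)).1 hu
      refine Nat.le_floor ?_
      calc ((J.filter (fun v => f v = u)).card : ℝ) ≤ k * Q.card := by exact_mod_cast hcard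
        _ ≤ k * ψ := by gcongr; exact hkiss u Q huQ hQ
    calc (J.card : ℝ) ≤ ⌊k * ψ⌋₊ * (J.image f).card := by exact_mod_cast hfloor
      _ ≤ _ := by gcongr; exact Nat.floor_le (by positivity)
  set P := (Finset.univ : Finset V).powersetCard s with hP
  set N := ((Fintype.card V).choose s : ℝ) with hN
  have hPN : (P.card : ℝ) = N := by simp [hP, hN]
  have hN0 : 0 ≤ N := Nat.cast_nonneg _
  have hmiss : ∀ S ∈ P, ¬ ((S ∩ I).card : ℝ) < μ / 2 →
      ((Finset.univ.filter (fun T : Fin t → V => ∀ i, T i ∉ (S ∩ I).image f)).card : ℝ) ≤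
        n ^ t * (1 / 10) := by
    intro S _ hS
    refine (card_forall_notMem_le _ t (10 * Real.sqrt n / (k * ψ)) ?_).trans ?_
    · rw [div_le_iff₀ (by positivity)]
      have := hfib (S ∩ I) Finset.inter_subset_right
      linarith
    · gcongr
      have hexp : 200 ≤ t * (10 * Real.sqrt n / (k * ψ)) / n := by
        rw [le_div_iff₀ hnpos]
        calc 200 * n = 20 * k * ψ * Real.sqrt n * (10 * Real.sqrt n / (k * ψ)) := by
              field_simp
              linarith
          _ ≤ _ := by gcongr
      rw [Real.exp_neg, ← one_div]
      refine one_div_le_one_div_of_le (by norm_num) ?_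
      linarith [Real.add_one_le_exp ((t : ℝ) * (10 * Real.sqrt n / (k * ψ)) / n)]
  set B := P.filter (fun S => ((S ∩ I).card : ℝ) < μ / 2) with hB
  have hBN : (B.card : ℝ) ≤ N / 5 := by
    have h1 : (B.card : ℝ) * μ ≤ 4 * N :=
      card_filter_card_inter_lt_mul_le I s μ hμ (by linarith)
    have h2 : (B.card : ℝ) * 20 ≤ B.card * μ := by gcongr
    linarith
  have hbad : (((P ×ˢ (Finset.univ : Finset (Fin t → V))).filter
      (fun ST => ∀ i, ST.2 i ∉ (ST.1 ∩ I).image f)).card : ℝ) ≤ N * n ^ t * (3 / 10) := by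
    rw [Finset.card_filter, Finset.sum_product]
    simp_rw [← Finset.card_filter]
    push_cast
    calc ∑ S ∈ P, ((Finset.univ.filter
          (fun T : Fin t → V => ∀ i, T i ∉ (S ∩ I).image f)).card : ℝ)
        ≤ ∑ S ∈ P, ((if ((S ∩ I).card : ℝ) < μ / 2 then n ^ t else 0) + n ^ t * (1 / 10)) := by
          refine Finset.sum_le_sum fun S hS => ?_
          split_ifs with h
          · have h1 : ((Finset.univ.filter
                (fun T : Fin t → V => ∀ i, T i ∉ (S ∩ I).image f)).card : ℝ) ≤ n ^ t := by
              have := Finset.card_le_univ (Finset.univ.filter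
                (fun T : Fin t → V => ∀ i, T i ∉ (S ∩ I).image f))
              rw [Fintype.card_fun, Fintype.card_fin] at this
              rw [hn]
              exact_mod_cast this
            have : 0 ≤ n ^ t * (1 / 10) := by positivity
            linarith
          · rw [zero_add]
            exact hmiss S hS h
      _ = B.card * n ^ t + N * (n ^ t * (1 / 10)) := by
          rw [Finset.sum_add_distrib, ← Finset.sum_filter, Finset.sum_const, Finset.sum_const,
            nsmul_eq_mul, nsmul_eq_mul, hPN]
      _ ≤ N / 5 * n ^ t + N * (n ^ t * (1 / 10)) := by gcongr
      _ = _ := by ring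
  have htotal := Finset.card_filter_add_card_filter_not
    (s := P ×ˢ (Finset.univ : Finset (Fin t → V)))
    (fun ST => ∀ i, ST.2 i ∉ (ST.1 ∩ I).image f)
  have htotal' : (((P ×ˢ (Finset.univ : Finset (Fin t → V))).filter
      (fun ST => ∀ i, ST.2 i ∉ (ST.1 ∩ I).image f)).card : ℝ) +
      ((P ×ˢ (Finset.univ : Finset (Fin t → V))).filter
      (fun ST => ¬ ∀ i, ST.2 i ∉ (ST.1 ∩ I).image f)).card = N * n ^ t := by
    rw [Finset.card_product, Finset.card_univ, Fintype.card_fun, Fintype.card_fin] at htotal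
    rw [← hPN, hn]
    exact_mod_cast htotal
  calc (2 / 3 : ℝ) * (N * n ^ t) ≤ ((P ×ˢ (Finset.univ : Finset (Fin t → V))).filter
      (fun ST => ¬ ∀ i, ST.2 i ∉ (ST.1 ∩ I).image f)).card := by
        have : 0 ≤ N * n ^ t := by positivity
        linarith
    _ ≤ _ := by
        refine Nat.cast_le.2 (Finset.card_le_card (Finset.monotone_filter_right _ ?_))
        rintro ⟨S, T⟩ - hST
        simp only [not_forall, not_not] at hST
        obtain ⟨i, hi⟩ := hST
        obtain ⟨v, hv, hvi⟩ := Finset.mem_image.1 hi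
        obtain ⟨hvS, hvI⟩ := Finset.mem_inter.1 hv
        have hfv := hf v hvI
        rw [hvi] at hfv
        exact ⟨v, hvS, Or.inr ⟨i, hfv⟩⟩
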